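/- Let W be a regular reachability or safety objective over C and M a finite chromatic memory structure. Then M suffices to play optimally for W in all arenas (of any cardinality) if and only if M suffices to play optimally for W in all finite one-player arenas of Player 1. -/

import Mathlib

set_option autoImplicit false

namespace RegularMemory

/-- Concatenation of a finite word with an infinite word. -/
def wcat {C : Type} (w : List C) (x : ℕ → C) : ℕ → C := fun n =>
  if h : n < w.length then w.get ⟨n, h⟩ else x (n - w.length)

/-- The infinite word `w^ω` (junk value if `w` is empty). -/
noncomputable def wpow {C : Type} [Nonempty C] : List C → ℕ → C
  | [] => fun _ => Classical.arbitrary C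
  | (a :: l) => fun n => (a :: l).get ⟨n % (a :: l).length, Nat.mod_lt n (Nat.succ_pos _)⟩

/-- Winning continuations `w⁻¹W` of the finite word `w` for the objective `W`. -/
def contAfter {C : Type} (W : Set (ℕ → C)) (w : List C) : Set (ℕ → C) :=
  {x | wcat w x ∈ W}

/-- Prefix preorder `w₁ ⪯_W w₂`. -/
def prefLe {C : Type} (W : Set (ℕ → C)) (w₁ w₂ : List C) : Prop :=
  contAfter W w₁ ⊆ contAfter W w₂

/-- Strict prefix relation `w₁ ≺_W w₂`. -/
def prefLt {C : Type} (W : Set (ℕ → C)) (w₁ w₂ : List C) : Prop :=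
  prefLe W w₁ w₂ ∧ ¬ prefLe W w₂ w₁

/-- Comparability for the prefix preorder. -/
def PrefComparable {C : Type} (W : Set (ℕ → C)) (w₁ w₂ : List C) : Prop :=
  prefLe W w₁ w₂ ∨ prefLe W w₂ w₁

/-- The general reachability objective derived from `A`: infinite words with a prefix in `A`. -/
def ReachObj {C : Type} (A : Set (List C)) : Set (ℕ → C) :=
  {x | ∃ n : ℕ, (List.ofFn fun i : Fin n => x i) ∈ A}

/-- The general safety objective derived from `A`. -/
def SafeObj {C : Type} (A : Set (List C)) : Set (ℕ → C) :=
  (ReachObj A)ᶜ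

/-- The prefix preorder of `W` has finitely many equivalence classes. -/
def FinClasses {C : Type} (W : Set (ℕ → C)) : Prop :=
  (Set.range fun w : List C => contAfter W w).Finite

/-- The prefix preorder of `W` is well-founded:
every nonempty chain contains a minimal element. -/
def PrefWellFounded {C : Type} (W : Set (ℕ → C)) : Prop :=
  ∀ S : Set (List C), S.Nonempty →
    (∀ w₁ ∈ S, ∀ w₂ ∈ S, PrefComparable W w₁ w₂) →
    ∃ w₀ ∈ S, ∀ w ∈ S, ¬ prefLt W w w₀

/-- Chromatic memory structure. -/
structure MemStruct (C : Type) where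
  M : Type
  init : M
  upd : M → C → M

/-- Extension of the update function to finite words. -/
def MemStruct.updStar {C : Type} (N : MemStruct C) (m : N.M) (w : List C) : N.M :=
  w.foldl N.upd m

/-- The trivial one-state memory structure. -/
def trivMem (C : Type) : MemStruct C :=
  ⟨Unit, (), fun _ _ => ()⟩

/-- `W` is `N`-strongly-monotone. -/
def StronglyMonotone {C : Type} (N : MemStruct C) (W : Set (ℕ → C)) : Prop :=
  ∀ w₁ w₂ : List C,
    N.updStar N.init w₁ = N.updStar N.init w₂ → PrefComparable W w₁ w₂

/-- `W` is `N`-progress-consistent. -/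
def ProgressConsistent {C : Type} [Nonempty C] (N : MemStruct C) (W : Set (ℕ → C)) : Prop :=
  ∀ (m : N.M) (w₁ w₂ : List C),
    N.updStar N.init w₁ = m → N.updStar m w₂ = m →
    prefLt W w₁ (w₁ ++ w₂) → wcat w₁ (wpow w₂) ∈ W

/-- Two-player arena with colored edges; Player-1 vertices have outgoing edges
(so that strategies of Player 1 exist). -/
structure Arena (C : Type) where
  V : Type
  P1 : V → Prop
  E : Set (V × C × V)
  succ : ∀ v : V, P1 v → ∃ e ∈ E, e.1 = v

namespace Arena

/-- Valid histories starting at a given vertex. -/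
def HistFrom {C : Type} (A : Arena C) : A.V → List (A.V × C × A.V) → Prop
  | _, [] => True
  | v, e :: l => e ∈ A.E ∧ e.1 = v ∧ HistFrom A e.2.2 l

/-- Endpoint of a history. -/
def endFrom {C : Type} (A : Arena C) : A.V → List (A.V × C × A.V) → A.V
  | v, [] => v
  | _, e :: l => endFrom A e.2.2 l

/-- Infinite plays from a vertex. -/
def PlayFrom {C : Type} (A : Arena C) (v : A.V) (π : ℕ → A.V × C × A.V) : Prop :=
  (π 0).1 = v ∧ ∀ n : ℕ, π n ∈ A.E ∧ (π n).2.2 = (π (n + 1)).1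

/-- Colors along a play. -/
def playCol {C V : Type} (π : ℕ → V × C × V) : ℕ → C :=
  fun n => (π n).2.1

/-- Strategies of Player 1: on every valid history ending in a Player-1 vertex,
the strategy picks an edge leaving that vertex. -/
structure Strategy {C : Type} (A : Arena C) where
  next : A.V → List (A.V × C × A.V) → A.V × C × A.V
  legal : ∀ (v : A.V) (l : List (A.V × C × A.V)),
    A.HistFrom v l → A.P1 (A.endFrom v l) →
      next v l ∈ A.E ∧ (next v l).1 = A.endFrom v l

/-- A play from `v` is consistent with the strategy `σ`. -/
def Strategy.Consistent {C : Type} {A : Arena C} (σ : A.Strategy) (v : A.V)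
    (π : ℕ → A.V × C × A.V) : Prop :=
  ∀ n : ℕ, A.P1 (A.endFrom v (List.ofFn fun i : Fin n => π i)) →
    π n = σ.next v (List.ofFn fun i : Fin n => π i)

/-- `σ` is winning from `v` for the objective `W`. -/
def Strategy.WinningFrom {C : Type} {A : Arena C} (σ : A.Strategy)
    (W : Set (ℕ → C)) (v : A.V) : Prop :=
  ∀ π : ℕ → A.V × C × A.V, A.PlayFrom v π → σ.Consistent v π → playCol π ∈ W

/-- `σ` is optimal in `(A, W)`: winning from every vertex from which
Player 1 has some winning strategy. -/
def Strategy.Optimal {C : Type} {A : Arena C} (σ : A.Strategy) (W : Set (ℕ → C)) : Prop :=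
  ∀ v : A.V, (∃ σ' : A.Strategy, σ'.WinningFrom W v) → σ.WinningFrom W v

/-- `σ` is based on the memory structure `N`. -/
def Strategy.BasedOn {C : Type} {A : Arena C} (σ : A.Strategy) (N : MemStruct C) : Prop :=
  ∃ nxt : A.V → N.M → A.V × C × A.V,
    ∀ (v : A.V) (l : List (A.V × C × A.V)),
      A.HistFrom v l → A.P1 (A.endFrom v l) →
        σ.next v l = nxt (A.endFrom v l) (N.updStar N.init (l.map fun e => e.2.1))

/-- Finite arena: finitely many vertices and edges. -/
def IsFinite {C : Type} (A : Arena C) : Prop := Finite A.V ∧ A.E.Finite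

/-- Finitely branching arena. -/
def FinBranching {C : Type} (A : Arena C) : Prop :=
  ∀ v : A.V, {e ∈ A.E | e.1 = v}.Finite

/-- One-player arena of Player 1. -/
def OneP1 {C : Type} (A : Arena C) : Prop := ∀ v : A.V, A.P1 v

end Arena

/-- `N` suffices to play optimally for `W` in all arenas of the class `P`. -/
def SufficesIn {C : Type} (N : MemStruct C) (W : Set (ℕ → C))
    (P : Arena C → Prop) : Prop :=
  ∀ A : Arena C, P A → ∃ σ : A.Strategy, σ.BasedOn N ∧ σ.Optimal W

/-- Deterministic automaton (with complete transition function). -/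
structure DetAuto (C : Type) where
  Q : Type
  init : Q
  δ : Q → C → Q
  F : Set Q

/-- Extension of the transition function to finite words. -/
def DetAuto.δStar {C : Type} (D : DetAuto C) (q : D.Q) (w : List C) : D.Q :=
  w.foldl D.δ q

/-- Language recognized by `D`. -/
def DetAuto.lang {C : Type} (D : DetAuto C) : Set (List C) :=
  {w | D.δStar D.init w ∈ D.F}

/-- Prefix preorder extended to automaton states. -/
def statePrefLe {C : Type} (D : DetAuto C) (W : Set (ℕ → C)) (q₁ q₂ : D.Q) : Prop :=
  ∀ w₁ w₂ : List C,
    D.δStar D.init w₁ = q₁ → D.δStar D.init w₂ = q₂ → prefLe W w₁ w₂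

def statePrefLt {C : Type} (D : DetAuto C) (W : Set (ℕ → C)) (q₁ q₂ : D.Q) : Prop :=
  statePrefLe D W q₁ q₂ ∧ ¬ statePrefLe D W q₂ q₁

def StateComparable {C : Type} (D : DetAuto C) (W : Set (ℕ → C)) (q₁ q₂ : D.Q) : Prop :=
  statePrefLe D W q₁ q₂ ∨ statePrefLe D W q₂ q₁

/-- Monotone decomposition of `D` with `k` sets. -/
def MonotoneDecomposition {C : Type} (D : DetAuto C) (W : Set (ℕ → C))
    {k : ℕ} (Γ : Fin k → Set D.Q) : Prop :=
  (∀ q : D.Q, ∃ i : Fin k, q ∈ Γ i) ∧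
  (∀ (c : C) (i : Fin k), ∃ j : Fin k, (fun q => D.δ q c) '' Γ i ⊆ Γ j) ∧
  (∀ i : Fin k, ∀ q₁ ∈ Γ i, ∀ q₂ ∈ Γ i, StateComparable D W q₁ q₂)

end RegularMemory


namespace RegularMemory

variable {C : Type}

/-- The prefix of length `n` of an infinite word. -/
def initSeg (x : ℕ → C) (n : ℕ) : List C := List.ofFn fun i : Fin n => x i

lemma length_initSeg (x : ℕ → C) (n : ℕ) : (initSeg x n).length = n := by
  simp [initSeg]

lemma initSeg_zero (x : ℕ → C) : initSeg x 0 = [] := by simp [initSeg]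

lemma initSeg_succ (x : ℕ → C) (n : ℕ) : initSeg x (n + 1) = initSeg x n ++ [x n] := by
  simp only [initSeg, List.ofFn_succ', List.concat_eq_append]
  simp

lemma initSeg_add (x : ℕ → C) (m n : ℕ) :
    initSeg x (m + n) = initSeg x m ++ initSeg (fun k => x (m + k)) n := by
  induction n with
  | zero => simp [initSeg_zero]
  | succ n ih => rw [← Nat.add_assoc, initSeg_succ, ih, initSeg_succ, List.append_assoc]

lemma initSeg_congr {x y : ℕ → C} {n : ℕ} (h : ∀ i < n, x i = y i) :
    initSeg x n = initSeg y n := by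
  simp only [initSeg]
  congr 1
  funext i
  exact h i i.2

lemma wcat_nil (x : ℕ → C) : wcat [] x = x := by
  funext n; simp [wcat]

lemma wcat_cons_zero (a : C) (w : List C) (x : ℕ → C) : wcat (a :: w) x 0 = a := by
  simp [wcat]

lemma wcat_cons_succ (a : C) (w : List C) (x : ℕ → C) (n : ℕ) :
    wcat (a :: w) x (n + 1) = wcat w x n := by
  simp [wcat]

lemma wcat_append (u v : List C) (x : ℕ → C) : wcat (u ++ v) x = wcat u (wcat v x) := by
  induction u with
  | nil => simp [wcat_nil]
  | cons a u ih =>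
    funext n
    cases n with
    | zero => simp [wcat_cons_zero]
    | succ n => rw [List.cons_append, wcat_cons_succ, wcat_cons_succ, ih]

lemma wcat_lt {w : List C} (x : ℕ → C) {n : ℕ} (h : n < w.length) : wcat w x n = w[n] := by
  simp [wcat, h]

lemma wcat_length_add (w : List C) (x : ℕ → C) (n : ℕ) : wcat w x (w.length + n) = x n := by
  simp [wcat]

lemma initSeg_wcat (w : List C) (x : ℕ → C) (n : ℕ) :
    initSeg (wcat w x) (w.length + n) = w ++ initSeg x n := by
  have h : initSeg (wcat w x) w.length = w := by
    refine List.ext_getElem (length_initSeg _ _) fun i h₁ h₂ => ?_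
    simp [initSeg, wcat_lt x h₂]
  rw [initSeg_add, h]
  simp only [wcat_length_add]

lemma wcat_initSeg (x : ℕ → C) (n : ℕ) : wcat (initSeg x n) (fun k => x (n + k)) = x := by
  induction n with
  | zero => simp [initSeg_zero, wcat_nil]
  | succ n ih =>
    rw [initSeg_succ, wcat_append]
    convert ih using 2
    funext k
    cases k with
    | zero => simp [wcat_cons_zero]
    | succ k => rw [wcat_cons_succ, wcat_nil]; congr 1; omega

lemma eq_wpow_of_eq_wcat [Nonempty C] {w : List C} (hw : w ≠ []) {y : ℕ → C}
    (hy : y = wcat w y) : y = wpow w := by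
  obtain ⟨a, l, rfl⟩ := List.exists_cons_of_ne_nil hw
  funext n
  induction n using Nat.strong_induction_on with
  | _ n ih =>
    rw [hy]
    by_cases h : n < (a :: l).length
    · rw [wcat_lt _ h]
      simp only [wpow, List.get_eq_getElem, Nat.mod_eq_of_lt h]
    · obtain ⟨k, rfl⟩ := Nat.exists_eq_add_of_le (not_lt.mp h)
      rw [wcat_length_add, ih k (by simp)]
      simp only [wpow, Nat.add_mod_left]

lemma wpow_eq_wcat [Nonempty C] {w : List C} (hw : w ≠ []) : wpow w = wcat w (wpow w) := by
  obtain ⟨a, l, rfl⟩ := List.exists_cons_of_ne_nil hw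
  funext n
  by_cases h : n < (a :: l).length
  · rw [wcat_lt _ h]
    simp only [wpow, List.get_eq_getElem, Nat.mod_eq_of_lt h]
  · obtain ⟨k, rfl⟩ := Nat.exists_eq_add_of_le (not_lt.mp h)
    rw [wcat_length_add]
    simp only [wpow, Nat.add_mod_left]

lemma contAfter_nil (q : Set (ℕ → C)) : contAfter q [] = q := by
  simp [contAfter, wcat_nil]

lemma contAfter_append (q : Set (ℕ → C)) (u v : List C) :
    contAfter q (u ++ v) = contAfter (contAfter q u) v := by
  ext x; simp [contAfter, wcat_append]

lemma contAfter_mono {q q' : Set (ℕ → C)} (h : q ⊆ q') (w : List C) :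
    contAfter q w ⊆ contAfter q' w := fun _ hx => h hx

lemma contAfter_univ (w : List C) : contAfter (Set.univ : Set (ℕ → C)) w = Set.univ := rfl

lemma contAfter_empty (w : List C) : contAfter (∅ : Set (ℕ → C)) w = ∅ := rfl

lemma mem_contAfter_initSeg {q : Set (ℕ → C)} {x : ℕ → C} {n : ℕ} :
    (fun k => x (n + k)) ∈ contAfter q (initSeg x n) ↔ x ∈ q := by
  simp [contAfter, wcat_initSeg]

lemma mem_of_contAfter_initSeg {q : Set (ℕ → C)} {x : ℕ → C} {n : ℕ}
    (h : contAfter q (initSeg x n) = Set.univ) : x ∈ q := by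
  rw [← mem_contAfter_initSeg (n := n), h]; trivial

lemma notMem_of_contAfter_initSeg {q : Set (ℕ → C)} {x : ℕ → C} {n : ℕ}
    (h : contAfter q (initSeg x n) = ∅) : x ∉ q := by
  rw [← mem_contAfter_initSeg (n := n), h]; exact fun h => h

/-- Every word of the objective has a prefix all of whose continuations are winning. -/
def OpenObj (q : Set (ℕ → C)) : Prop :=
  ∀ x ∈ q, ∃ n, contAfter q (initSeg x n) = Set.univ

/-- Every word outside the objective has a prefix none of whose continuations is winning. -/
def ClosedObj (q : Set (ℕ → C)) : Prop :=
  ∀ x ∉ q, ∃ n, contAfter q (initSeg x n) = ∅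

lemma wcat_initSeg_mem_reachObj {A : Set (List C)} {x y : ℕ → C} {n : ℕ}
    (h : initSeg x n ∈ A) : wcat (initSeg x n) y ∈ ReachObj A := by
  refine ⟨n, ?_⟩
  change initSeg _ n ∈ A
  have := initSeg_wcat (initSeg x n) y 0
  rw [length_initSeg, Nat.add_zero, initSeg_zero, List.append_nil] at this
  rwa [this]

lemma openObj_reachObj (A : Set (List C)) : OpenObj (ReachObj A) := fun _ ⟨n, hn⟩ =>
  ⟨n, Set.eq_univ_of_forall fun _ => wcat_initSeg_mem_reachObj hn⟩

lemma closedObj_safeObj (A : Set (List C)) : ClosedObj (SafeObj A) := fun _ hx => by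
  obtain ⟨n, hn⟩ := not_not.mp hx
  exact ⟨n, Set.eq_empty_of_forall_notMem fun _ hy => hy (wcat_initSeg_mem_reachObj hn)⟩

lemma contAfter_initSeg_univ_of_le {q : Set (ℕ → C)} {x : ℕ → C} {m n : ℕ} (hmn : m ≤ n)
    (h : contAfter q (initSeg x m) = Set.univ) : contAfter q (initSeg x n) = Set.univ := by
  obtain ⟨k, rfl⟩ := Nat.exists_eq_add_of_le hmn
  rw [initSeg_add, contAfter_append, h, contAfter_univ]

lemma contAfter_initSeg_empty_of_le {q : Set (ℕ → C)} {x : ℕ → C} {m n : ℕ} (hmn : m ≤ n)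
    (h : contAfter q (initSeg x m) = ∅) : contAfter q (initSeg x n) = ∅ := by
  obtain ⟨k, rfl⟩ := Nat.exists_eq_add_of_le hmn
  rw [initSeg_add, contAfter_append, h, contAfter_empty]

lemma OpenObj.contAfter {q : Set (ℕ → C)} (hq : OpenObj q) (w : List C) :
    OpenObj (contAfter q w) := fun x hx => by
  obtain ⟨n, hn⟩ := hq _ hx
  refine ⟨n, ?_⟩
  rw [← contAfter_append, ← initSeg_wcat]
  exact contAfter_initSeg_univ_of_le (Nat.le_add_left _ _) hn

lemma ClosedObj.contAfter {q : Set (ℕ → C)} (hq : ClosedObj q) (w : List C) :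
    ClosedObj (contAfter q w) := fun x hx => by
  obtain ⟨n, hn⟩ := hq _ hx
  refine ⟨n, ?_⟩
  rw [← contAfter_append, ← initSeg_wcat]
  exact contAfter_initSeg_empty_of_le (Nat.le_add_left _ _) hn

lemma FinClasses.contAfter {q : Set (ℕ → C)} (hq : FinClasses q) (w : List C) :
    FinClasses (contAfter q w) := by
  refine Set.Finite.subset hq ?_
  rintro _ ⟨u, rfl⟩
  exact ⟨w ++ u, contAfter_append q w u⟩

lemma exists_agreement_bound {q : Set (ℕ → C)} (hq : OpenObj q ∨ ClosedObj q) (x : ℕ → C) :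
    ∃ N, ∀ y, initSeg y N = initSeg x N →
      (∀ j, ∃ i, contAfter q (initSeg y j) = contAfter q (initSeg x i)) →
      (y ∈ q ↔ x ∈ q) := by
  by_cases hx : x ∈ q
  · rcases hq with hq | hq
    · obtain ⟨N, hN⟩ := hq x hx
      exact ⟨N, fun y hy _ => iff_of_true (mem_of_contAfter_initSeg (hy ▸ hN)) hx⟩
    · refine ⟨0, fun y _ hy => iff_of_true (by_contra fun hyq => ?_) hx⟩
      obtain ⟨j, hj⟩ := hq y hyq
      obtain ⟨i, hi⟩ := hy j
      exact notMem_of_contAfter_initSeg (hi ▸ hj) hx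
  · rcases hq with hq | hq
    · refine ⟨0, fun y _ hy => iff_of_false (fun hyq => ?_) hx⟩
      obtain ⟨j, hj⟩ := hq y hyq
      obtain ⟨i, hi⟩ := hy j
      exact hx (mem_of_contAfter_initSeg (hi ▸ hj))
    · obtain ⟨N, hN⟩ := hq x hx
      exact ⟨N, fun y hy _ => iff_of_false (notMem_of_contAfter_initSeg (hy ▸ hN)) hx⟩

/-- Successor on the lasso with positions `0, …, n - 1` whose last position leads back to `k`. -/
def lassoStep (k n i : ℕ) : ℕ := if i + 1 = n then k else i + 1

/-- The ultimately periodic word that reads `x` along a lasso. -/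
def lasso (k n : ℕ) (x : ℕ → C) : ℕ → C := fun j => x ((lassoStep k n)^[j] 0)

lemma lassoStep_lt {k n i : ℕ} (hkn : k < n) (hi : i < n) : lassoStep k n i < n := by
  unfold lassoStep
  split_ifs <;> omega

lemma lassoStep_iterate {k n j : ℕ} (hj : j < n) : (lassoStep k n)^[j] 0 = j := by
  induction j with
  | zero => rfl
  | succ j ih =>
    rw [Function.iterate_succ_apply', ih (by omega), lassoStep, if_neg (by omega)]

lemma contAfter_initSeg_lasso {q : Set (ℕ → C)} {x : ℕ → C} {k n : ℕ}
    (h : contAfter q (initSeg x k) = contAfter q (initSeg x n)) (j : ℕ) :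
    contAfter q (initSeg (lasso k n x) j) =
      contAfter q (initSeg x ((lassoStep k n)^[j] 0)) := by
  induction j with
  | zero => simp [initSeg_zero]
  | succ j ih =>
    rw [initSeg_succ, contAfter_append, ih, Function.iterate_succ_apply', lasso,
      ← contAfter_append, ← initSeg_succ]
    generalize (lassoStep k n)^[j] 0 = i
    unfold lassoStep
    split_ifs with hi
    · rw [hi, h]
    · rfl

lemma exists_lasso {q₁ q₂ : Set (ℕ → C)} (h₁ : OpenObj q₁ ∨ ClosedObj q₁)
    (h₂ : OpenObj q₂ ∨ ClosedObj q₂) (hf₁ : FinClasses q₁) (hf₂ : FinClasses q₂)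
    (x : ℕ → C) :
    ∃ k n, k < n ∧ (lasso k n x ∈ q₁ ↔ x ∈ q₁) ∧ (lasso k n x ∈ q₂ ↔ x ∈ q₂) := by
  obtain ⟨N₁, hN₁⟩ := exists_agreement_bound h₁ x
  obtain ⟨N₂, hN₂⟩ := exists_agreement_bound h₂ x
  let F : ℕ → (Set.range fun w => contAfter q₁ w) × (Set.range fun w => contAfter q₂ w) :=
    fun i => (⟨_, initSeg x (N₁ + N₂ + i), rfl⟩, ⟨_, initSeg x (N₁ + N₂ + i), rfl⟩)
  have : Finite (Set.range fun w => contAfter q₁ w) := hf₁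
  have : Finite (Set.range fun w => contAfter q₂ w) := hf₂
  obtain ⟨a, b, hab, hF⟩ : ∃ a b, a < b ∧ F a = F b := by
    obtain ⟨a, b, hab, hF⟩ := Finite.exists_ne_map_eq_of_infinite F
    rcases hab.lt_or_gt with h | h
    exacts [⟨a, b, h, hF⟩, ⟨b, a, h, hF.symm⟩]
  have hF₁ := congrArg (fun p => p.1.1) hF
  have hF₂ := congrArg (fun p => p.2.1) hF
  have agree : ∀ N ≤ N₁ + N₂,
      initSeg (lasso (N₁ + N₂ + a) (N₁ + N₂ + b) x) N = initSeg x N := fun N hN =>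
    initSeg_congr fun i hi => by rw [lasso, lassoStep_iterate (by omega)]
  exact ⟨N₁ + N₂ + a, N₁ + N₂ + b, by omega,
    hN₁ _ (agree _ (by omega)) fun j => ⟨_, contAfter_initSeg_lasso hF₁ j⟩,
    hN₂ _ (agree _ (by omega)) fun j => ⟨_, contAfter_initSeg_lasso hF₂ j⟩⟩

namespace Arena

lemma endFrom_concat (A : Arena C) (v : A.V) (l : List (A.V × C × A.V))
    (e : A.V × C × A.V) : A.endFrom v (l ++ [e]) = e.2.2 := by
  induction l generalizing v with
  | nil => rfl
  | cons a l ih => exact ih _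

lemma histFrom_concat (A : Arena C) (v : A.V) (l : List (A.V × C × A.V))
    (e : A.V × C × A.V) :
    A.HistFrom v (l ++ [e]) ↔ A.HistFrom v l ∧ e ∈ A.E ∧ e.1 = A.endFrom v l := by
  induction l generalizing v with
  | nil => simp [HistFrom, endFrom]
  | cons a l ih => simp [HistFrom, endFrom, ih, and_assoc]

lemma PlayFrom.endFrom_initSeg {A : Arena C} {v : A.V} {π : ℕ → A.V × C × A.V}
    (h : A.PlayFrom v π) (n : ℕ) : A.endFrom v (initSeg π n) = (π n).1 := by
  cases n with
  | zero => simp [initSeg_zero, endFrom, h.1]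
  | succ n => rw [initSeg_succ, endFrom_concat, (h.2 n).2]

lemma PlayFrom.histFrom_initSeg {A : Arena C} {v : A.V} {π : ℕ → A.V × C × A.V}
    (h : A.PlayFrom v π) (n : ℕ) : A.HistFrom v (initSeg π n) := by
  induction n with
  | zero => simp [initSeg_zero, HistFrom]
  | succ n ih =>
    rw [initSeg_succ, histFrom_concat]
    exact ⟨ih, (h.2 n).1, (h.endFrom_initSeg n).symm⟩

lemma map_color_initSeg {V : Type} (π : ℕ → V × C × V) (n : ℕ) :
    (initSeg π n).map (fun e => e.2.1) = initSeg (playCol π) n := by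
  simp only [initSeg, List.map_ofFn]
  rfl

/-- The strategy of Player 1 induced by a next-move function over a memory structure. -/
def memStrategy {A : Arena C} {N : MemStruct C} (nxt : A.V → N.M → A.V × C × A.V)
    (h : ∀ v m, A.P1 v → nxt v m ∈ A.E ∧ (nxt v m).1 = v) : A.Strategy where
  next v l := nxt (A.endFrom v l) (N.updStar N.init (l.map fun e => e.2.1))
  legal _ _ _ hl := h _ _ hl

lemma Strategy.Consistent.eq_memStrategy {A : Arena C} {N : MemStruct C}
    {nxt : A.V → N.M → A.V × C × A.V}
    {h : ∀ v m, A.P1 v → nxt v m ∈ A.E ∧ (nxt v m).1 = v} {v : A.V}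
    {π : ℕ → A.V × C × A.V} (hπ : A.PlayFrom v π)
    (hc : (memStrategy nxt h).Consistent v π) (n : ℕ) (hn : A.P1 (π n).1) :
    π n = nxt (π n).1 (N.updStar N.init (initSeg (playCol π) n)) := by
  have := hc n
  change A.P1 (A.endFrom v (initSeg π n)) → π n = nxt (A.endFrom v (initSeg π n))
    (N.updStar N.init ((initSeg π n).map fun e => e.2.1)) at this
  rw [hπ.endFrom_initSeg, map_color_initSeg] at this
  exact this hn

open Classical in
/-- In a one-player arena, Player 1 can follow any given play. -/
lemma exists_winningFrom_of_play {A : Arena C} (hA : A.OneP1) {W : Set (ℕ → C)} {v : A.V}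
    {π : ℕ → A.V × C × A.V} (hπ : A.PlayFrom v π) (hW : playCol π ∈ W) :
    ∃ σ : A.Strategy, σ.WinningFrom W v := by
  choose e he using fun u => A.succ u (hA u)
  refine ⟨⟨fun u l => if u = v ∧ l = initSeg π l.length then π l.length
    else e (A.endFrom u l), fun u l _ _ => ?_⟩, fun π' _ hc => ?_⟩
  · split_ifs with h
    · obtain ⟨rfl, hl⟩ := h
      refine ⟨(hπ.2 _).1, ?_⟩
      conv_rhs => rw [hl, hπ.endFrom_initSeg]
    · exact he _
  · suffices π' = π from this ▸ hW
    funext n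
    induction n using Nat.strong_induction_on with
    | _ n ih =>
      have hn := hc n (hA _)
      change π' n = if v = v ∧ initSeg π' n = initSeg π (initSeg π' n).length
        then π (initSeg π' n).length else e (A.endFrom v (initSeg π' n)) at hn
      rwa [length_initSeg, if_pos ⟨rfl, initSeg_congr ih⟩] at hn

end Arena

open Arena

lemma MemStruct.updStar_append (N : MemStruct C) (m : N.M) (u v : List C) :
    N.updStar m (u ++ v) = N.updStar (N.updStar m u) v := by
  simp [updStar]

/-- The one-player arena in which every vertex `v` has the two outgoing edges `g b v`. -/
abbrev choiceArena {V : Type} (g : Bool → V → C × V) : Arena C where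
  V := V
  P1 _ := True
  E := {e | ∃ b, e.2 = g b e.1}
  succ v _ := ⟨(v, g true v), ⟨true, rfl⟩, rfl⟩

lemma choiceArena_finite {V : Type} [Finite V] (g : Bool → V → C × V) :
    (choiceArena g).IsFinite := by
  refine ⟨‹Finite V›, (Set.finite_range fun p : Bool × V => (p.2, g p.1 p.2)).subset ?_⟩
  rintro e ⟨b, hb⟩
  exact ⟨(b, e.1), Prod.ext rfl hb.symm⟩

/-- The play obtained by always following the edges given by `f`. -/
def run {V : Type} (f : V → C × V) (v : V) (n : ℕ) : V × C × V :=
  ((fun u => (f u).2)^[n] v, f ((fun u => (f u).2)^[n] v))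

lemma run_playFrom {V : Type} (g : Bool → V → C × V) (b : Bool) (v : V) :
    (choiceArena g).PlayFrom v (run (g b) v) :=
  ⟨rfl, fun n => ⟨⟨b, rfl⟩, by simp only [run, Function.iterate_succ_apply']⟩⟩

lemma playCol_run {V : Type} (f : V → C × V) (v : V) :
    playCol (run f v) = wcat [(f v).1] (playCol (run f (f v).2)) := by
  funext n
  cases n with
  | zero => rw [wcat_cons_zero]; rfl
  | succ n => rw [wcat_cons_succ, wcat_nil]; rfl

/-- If Player 1 has a real choice only at `s`, and `s` is always visited with the same memory
state, then one of the two choices is uniformly as good as any strategy. -/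
lemma exists_choice {V : Type} [Finite V] {N : MemStruct C} {W : Set (ℕ → C)}
    (hN : SufficesIn N W fun A => A.IsFinite ∧ A.OneP1) (g : Bool → V → C × V) (s : V)
    (hg : ∀ b b' v, v ≠ s → g b v = g b' v) (Inv : V → N.M → Prop) (m : N.M)
    (hInv : ∀ b v μ, Inv v μ → Inv (g b v).2 (N.upd μ (g b v).1))
    (hs : ∀ μ, Inv s μ → μ = m) :
    ∃ b, ∀ v, Inv v N.init →
      (∃ π, (choiceArena g).PlayFrom v π ∧ playCol π ∈ W) → playCol (run (g b) v) ∈ W := by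
  obtain ⟨σ, ⟨nxt, hnxt⟩, hopt⟩ := hN (choiceArena g) ⟨choiceArena_finite g, fun _ => trivial⟩
  obtain ⟨b, hb⟩ : ∃ b, ∀ b', (nxt s m).2 = g b' s → (nxt s m).2 = g b s := by
    by_cases h : ∃ b', (nxt s m).2 = g b' s
    · exact h.imp fun b hb _ _ => hb
    · exact ⟨true, fun b' hb' => absurd ⟨b', hb'⟩ h⟩
  refine ⟨b, fun v hv ⟨π, hπ, hπW⟩ => hopt v
    (exists_winningFrom_of_play (fun _ => trivial) hπ hπW) _ (run_playFrom g b v) ?_⟩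
  intro n _
  have hp := run_playFrom g b v
  have hl := σ.legal v _ (hp.histFrom_initSeg n) trivial
  have hx := hnxt v _ (hp.histFrom_initSeg n) trivial
  rw [hp.endFrom_initSeg] at hl hx
  rw [map_color_initSeg] at hx
  change run (g b) v n = σ.next v (initSeg (run (g b) v) n)
  have hinv : ∀ n, Inv (run (g b) v n).1
      (N.updStar N.init (initSeg (playCol (run (g b) v)) n)) := fun n => by
    induction n with
    | zero => simpa [initSeg_zero, MemStruct.updStar, run] using hv
    | succ n ih =>
      rw [initSeg_succ, N.updStar_append]
      have := hInv b _ _ ih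
      simp only [run, Function.iterate_succ_apply'] at this ⊢
      exact this
  obtain ⟨⟨b', hb'⟩, h1⟩ := hl
  refine Prod.ext h1.symm ?_
  rw [hb', h1]
  change g b (run (g b) v n).1 = _
  by_cases hu : (run (g b) v n).1 = s
  · have hm := hs _ (hu ▸ hinv n)
    rw [hm, hu] at hx
    rw [hu, ← hb b' (by rw [← hx, hb', h1, hu]), ← hx, hb', h1, hu]
  · exact hg _ _ _ hu

/-- `z` is the color sequence of some play from `v`. -/
def CanPlay (A : Arena C) (v : A.V) (z : ℕ → C) : Prop :=
  ∃ π, A.PlayFrom v π ∧ playCol π = z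

lemma canPlay_run {V : Type} (g : Bool → V → C × V) (b : Bool) (v : V) :
    CanPlay (choiceArena g) v (playCol (run (g b) v)) :=
  ⟨_, run_playFrom g b v, rfl⟩

lemma CanPlay.cons {A : Arena C} {v v' : A.V} {c : C} {z : ℕ → C} (he : (v, c, v') ∈ A.E)
    (h : CanPlay A v' z) : CanPlay A v (wcat [c] z) := by
  obtain ⟨π, ⟨h0, hπ⟩, rfl⟩ := h
  refine ⟨fun n => n.casesOn (v, c, v') π, ⟨rfl, fun n => ?_⟩, funext fun n => ?_⟩
  · cases n with
    | zero => exact ⟨he, h0.symm⟩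
    | succ n => exact hπ n
  · cases n with
    | zero => rw [wcat_cons_zero]; rfl
    | succ n => rw [wcat_cons_succ, wcat_nil]; rfl

lemma CanPlay.of_forall_eq {V : Type} {g : Bool → V → C × V} {u v : V} {d : Bool}
    (h : ∀ b, g b v = g d u) {z : ℕ → C} (hz : CanPlay (choiceArena g) v z) :
    CanPlay (choiceArena g) u z := by
  obtain ⟨π, ⟨h0, hπ⟩, rfl⟩ := hz
  obtain ⟨b, hb⟩ := (hπ 0).1
  refine ⟨fun n => n.casesOn (u, (π 0).2) fun n => π (n + 1), ⟨rfl, fun n => ?_⟩,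
    funext fun n => ?_⟩
  · cases n with
    | zero => exact ⟨⟨d, (hb.trans (by rw [h0])).trans (h b)⟩, (hπ 0).2⟩
    | succ n => exact hπ (n + 1)
  · cases n <;> rfl

/-- Vertices of the hub arena: the hub itself (`none`), the inner vertices of two paths labelled
by `w b` and leading to the hub, and the vertices of two lassos of size `n b`. -/
abbrev HubV (w : Bool → List C) (n : Bool → ℕ) : Type :=
  Option ((Σ b, Fin (w b).length) ⊕ (Σ b, Fin (n b)))

section Hub

variable {w : Bool → List C} {k n : Bool → ℕ}

variable (w n) in
/-- The vertex of the path labelled by `w b` in which `i` letters have been read. -/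
def hubEntry (b : Bool) (i : ℕ) : HubV w n :=
  if h : i < (w b).length then some (.inl ⟨b, ⟨i, h⟩⟩) else none

/-- The only edge leaving a vertex distinct from the hub. -/
def hubStep (hk : ∀ b, k b < n b) (x : Bool → ℕ → C) :
    (Σ b, Fin (w b).length) ⊕ (Σ b, Fin (n b)) → C × HubV w n
  | .inl ⟨b, i⟩ => ((w b)[i], hubEntry w n b (i + 1))
  | .inr ⟨b, i⟩ => (x b i, some (.inr ⟨b, ⟨lassoStep (k b) (n b) i, lassoStep_lt (hk b) i.2⟩⟩))

/-- The edge leaving a vertex when, in the hub, Player 1 imitates the vertex `t`. -/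
def hubEdge (hk : ∀ b, k b < n b) (x : Bool → ℕ → C)
    (t : (Σ b, Fin (w b).length) ⊕ (Σ b, Fin (n b))) : HubV w n → C × HubV w n
  | none => hubStep hk x t
  | some p => hubStep hk x p

variable {hk : ∀ b, k b < n b} {x : Bool → ℕ → C}
  {t : Bool → (Σ b, Fin (w b).length) ⊕ (Σ b, Fin (n b))}

lemma playCol_run_hub (s : (Σ b, Fin (w b).length) ⊕ (Σ b, Fin (n b))) :
    playCol (run (hubEdge hk x s) none) = playCol (run (hubEdge hk x s) (some s)) := by
  rw [playCol_run, playCol_run _ (some s)]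
  rfl

lemma playCol_run_lasso (s : (Σ b, Fin (w b).length) ⊕ (Σ b, Fin (n b))) (b : Bool) :
    playCol (run (hubEdge hk x s) (some (.inr ⟨b, ⟨0, (hk b).pos⟩⟩))) =
      lasso (k b) (n b) (x b) := by
  have key : ∀ j, ∃ h, (fun u => (hubEdge hk x s u).2)^[j]
      (some (.inr ⟨b, ⟨0, (hk b).pos⟩⟩)) =
        some (.inr ⟨b, ⟨(lassoStep (k b) (n b))^[j] 0, h⟩⟩) := fun j => by
    induction j with
    | zero => exact ⟨(hk b).pos, rfl⟩
    | succ j ih =>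
      obtain ⟨h, ih⟩ := ih
      simp only [Function.iterate_succ_apply', ih]
      exact ⟨lassoStep_lt (hk b) h, rfl⟩
  funext j
  obtain ⟨h, hj⟩ := key j
  simp only [playCol, run, hj]
  rfl

lemma hubEntry_induction {Φ : HubV w n → (ℕ → C) → Prop}
    (hΦ : ∀ p z, Φ (hubStep hk x p).2 z → Φ (some p) (wcat [(hubStep hk x p).1] z))
    {z : ℕ → C} (hz : Φ none z) (b : Bool) : Φ (hubEntry w n b 0) (wcat (w b) z) := by
  suffices ∀ j i, i + j = (w b).length →
      Φ (hubEntry w n b i) (wcat ((w b).drop i) z) by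
    simpa using this _ 0 (Nat.zero_add _)
  intro j
  induction j with
  | zero =>
    intro i hi
    rw [hubEntry, dif_neg (by omega), List.drop_eq_nil_of_le (by omega), wcat_nil]
    exact hz
  | succ j ih =>
    intro i hi
    have hlt : i < (w b).length := by omega
    rw [hubEntry, dif_pos hlt, List.drop_eq_getElem_cons hlt,
      show ∀ (a : C) l, a :: l = [a] ++ l from fun _ _ => rfl, wcat_append]
    exact hΦ (.inl ⟨b, ⟨i, hlt⟩⟩) _ (ih (i + 1) (by omega))

lemma playCol_run_entry (s : (Σ b, Fin (w b).length) ⊕ (Σ b, Fin (n b))) (b : Bool) :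
    playCol (run (hubEdge hk x s) (hubEntry w n b 0)) =
      wcat (w b) (playCol (run (hubEdge hk x s) none)) :=
  hubEntry_induction (hk := hk) (x := x)
    (Φ := fun v z => playCol (run (hubEdge hk x s) v) = z)
    (fun p z h => by rw [playCol_run, ← h]; rfl) rfl b

lemma canPlay_entry {z : ℕ → C}
    (hz : CanPlay (choiceArena fun d => hubEdge hk x (t d)) none z) (b : Bool) :
    CanPlay (choiceArena fun d => hubEdge hk x (t d)) (hubEntry w n b 0) (wcat (w b) z) :=
  hubEntry_induction (hk := hk) (x := x)
    (Φ := CanPlay (choiceArena fun d => hubEdge hk x (t d)))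
    (fun _ _ h => h.cons ⟨true, rfl⟩) hz b

/-- Memory states possible in the vertices of the hub arena, if the path labelled by `w b` is
entered with memory state `μ b` and the hub with memory state `m`. -/
def hubInv (N : MemStruct C) (μ : Bool → N.M) (m : N.M) : HubV w n → N.M → Prop
  | none, ν => ν = m
  | some (.inl ⟨b, i⟩), ν => ν = N.updStar (μ b) ((w b).take i)
  | some (.inr _), _ => True

lemma hubInv_entry {N : MemStruct C} {μ : Bool → N.M} {m : N.M}
    (hμ : ∀ b, N.updStar (μ b) (w b) = m) (b : Bool) (i : ℕ) :
    hubInv N μ m (hubEntry w n b i) (N.updStar (μ b) ((w b).take i)) := by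
  unfold hubEntry
  split_ifs with h
  · rfl
  · rw [List.take_of_length_le (not_lt.mp h)]
    exact hμ b

lemma hubInv_step {N : MemStruct C} {μ : Bool → N.M} {m : N.M}
    (hμ : ∀ b, N.updStar (μ b) (w b) = m)
    (p : (Σ b, Fin (w b).length) ⊕ (Σ b, Fin (n b))) (ν : N.M) (h : hubInv N μ m (some p) ν) :
    hubInv N μ m (hubStep hk x p).2 (N.upd ν (hubStep hk x p).1) := by
  obtain ⟨b, i⟩ | ⟨b, i⟩ := p
  · obtain rfl : ν = _ := h
    have := hubInv_entry (n := n) hμ b (i + 1)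
    rw [List.take_succ_eq_append_getElem i.2, N.updStar_append] at this
    exact this
  · trivial

lemma exists_hub_choice {N : MemStruct C} {W : Set (ℕ → C)}
    (hN : SufficesIn N W fun A => A.IsFinite ∧ A.OneP1) {μ : Bool → N.M} {m : N.M}
    (hμ : ∀ b, N.updStar (μ b) (w b) = m)
    (ht : ∀ d, hubInv N μ m (some (t d)) m) :
    ∃ d, ∀ b, μ b = N.init →
      (∃ z, CanPlay (choiceArena fun d => hubEdge hk x (t d)) none z ∧ wcat (w b) z ∈ W) →
      wcat (w b) (playCol (run (hubEdge hk x (t d)) none)) ∈ W := by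
  obtain ⟨d, hd⟩ := exists_choice hN (fun d => hubEdge hk x (t d)) none
    (fun b b' v hv => by cases v with | none => exact absurd rfl hv | some p => rfl)
    (hubInv N μ m) m
    (fun b v ν h => by
      cases v with
      | none =>
        obtain rfl : ν = m := h
        exact hubInv_step (hk := hk) hμ _ _ (ht b)
      | some p => exact hubInv_step (hk := hk) hμ _ _ h)
    (fun _ h => h)
  refine ⟨d, fun b hb ⟨z, hz, hzW⟩ => ?_⟩
  rw [← playCol_run_entry]
  refine hd _ ?_ ?_
  · have := hubInv_entry (n := n) hμ b 0
    rw [hb] at this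
    exact this
  · obtain ⟨π, hπ, hc⟩ := canPlay_entry hz b
    exact ⟨π, hπ, hc ▸ hzW⟩

end Hub

/-- Memory sufficient in finite one-player arenas makes the objective strongly monotone. -/
lemma stronglyMonotone_of_sufficesIn {W : Set (ℕ → C)} (hW : OpenObj W ∨ ClosedObj W)
    (hreg : FinClasses W) {N : MemStruct C}
    (hN : SufficesIn N W fun A => A.IsFinite ∧ A.OneP1) : StronglyMonotone N W := by
  intro w₁ w₂ hw
  by_contra hcomp
  obtain ⟨h₁₂, h₂₁⟩ := not_or.mp hcomp
  have hW' : ∀ w, OpenObj (contAfter W w) ∨ ClosedObj (contAfter W w) := fun w =>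
    hW.imp (·.contAfter w) (·.contAfter w)
  let w : Bool → List C := fun b => bif b then w₁ else w₂
  have hx : ∀ b, ∃ x k n, k < n ∧ lasso k n x ∈ contAfter W (w b) ∧
      lasso k n x ∉ contAfter W (w !b) := by
    intro b
    obtain ⟨x, hx₁, hx₂⟩ : ∃ x, x ∈ contAfter W (w b) ∧ x ∉ contAfter W (w !b) := by
      cases b
      exacts [Set.not_subset.mp h₂₁, Set.not_subset.mp h₁₂]
    obtain ⟨k, n, hkn, h₁, h₂⟩ :=
      exists_lasso (hW' (w b)) (hW' (w !b)) (hreg.contAfter _) (hreg.contAfter _) x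
    exact ⟨x, k, n, hkn, h₁.mpr hx₁, fun h => hx₂ (h₂.mp h)⟩
  choose x k n hk hin hout using hx
  have hrun : ∀ d, playCol (run (hubEdge hk x (.inr ⟨d, ⟨0, (hk d).pos⟩⟩)) none) =
      lasso (k d) (n d) (x d) := fun d =>
    (playCol_run_hub (w := w) _).trans (playCol_run_lasso _ d)
  obtain ⟨d, hd⟩ := exists_hub_choice (w := w) (hk := hk) (x := x)
    (t := fun d => .inr ⟨d, ⟨0, (hk d).pos⟩⟩) hN (μ := fun _ => N.init)
    (m := N.updStar N.init w₁) (by intro b; cases b; exacts [hw.symm, rfl])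
    (fun _ => trivial)
  have := hd (!d) rfl ⟨lasso (k !d) (n !d) (x !d), ?_, hin !d⟩
  · rw [hrun] at this
    exact hout d this
  · rw [← hrun]
    exact canPlay_run (fun d => hubEdge hk x (.inr ⟨d, ⟨0, (hk d).pos⟩⟩)) _ _

/-- Memory sufficient in finite one-player arenas makes the objective progress-consistent. -/
lemma progressConsistent_of_sufficesIn [Nonempty C] {W : Set (ℕ → C)}
    (hW : OpenObj W ∨ ClosedObj W) (hreg : FinClasses W) {N : MemStruct C}
    (hN : SufficesIn N W fun A => A.IsFinite ∧ A.OneP1) : ProgressConsistent N W := by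
  intro m w₁ w₂ h₁ h₂ hlt
  have hne : w₂ ≠ [] := by
    rintro rfl
    exact hlt.2 (by simp [prefLe])
  have hW' : ∀ w, OpenObj (contAfter W w) ∨ ClosedObj (contAfter W w) := fun w =>
    hW.imp (·.contAfter w) (·.contAfter w)
  obtain ⟨x, hx₁, hx₂⟩ := Set.not_subset.mp hlt.2
  obtain ⟨k, n, hkn, hl₁, hl₂⟩ :=
    exists_lasso (hW' (w₁ ++ w₂)) (hW' w₁) (hreg.contAfter _) (hreg.contAfter _) x
  let w : Bool → List C := fun b => bif b then w₁ else w₂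
  let t : Bool → (Σ b, Fin (w b).length) ⊕ (Σ _ : Bool, Fin n) := fun b =>
    bif b then .inr ⟨true, ⟨0, hkn.pos⟩⟩
    else .inl ⟨false, ⟨0, List.length_pos_iff.mpr hne⟩⟩
  have hentry : hubEntry w (fun _ => n) false 0 = some (t false) :=
    dif_pos (List.length_pos_iff.mpr hne)
  have hrun : playCol (run (hubEdge (fun _ => hkn) (fun _ => x) (t true)) none) =
      lasso k n x :=
    (playCol_run_hub _).trans
      (playCol_run_lasso (hk := fun _ => hkn) (x := fun _ => x) (t true) true)
  obtain ⟨d, hd⟩ := exists_hub_choice (w := w) (hk := fun _ => hkn) (x := fun _ => x)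
    (t := t) hN (μ := fun b => bif b then N.init else m) (m := m)
    (by intro b; cases b; exacts [h₂, h₁]) (by intro d; cases d; exacts [rfl, trivial])
  have hwin := hd true rfl ⟨wcat w₂ (lasso k n x), ?_, ?_⟩
  · cases d with
    | true =>
      rw [hrun] at hwin
      exact absurd (hl₂.mp hwin) hx₂
    | false =>
      have hloop := (playCol_run_hub (hk := fun _ => hkn) (x := fun _ => x) (t false)).trans
        (hentry ▸ playCol_run_entry (t false) false)
      rwa [eq_wpow_of_eq_wcat hne hloop] at hwin
  · refine CanPlay.of_forall_eq (v := some (t false)) (d := false) (fun _ => rfl) ?_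
    rw [← hentry]
    refine canPlay_entry ?_ false
    rw [← hrun]
    exact canPlay_run (fun d => hubEdge (fun _ => hkn) (fun _ => x) (t d)) true none
  · rw [← wcat_append]
    exact hl₁.mpr hx₁


/-- The winning continuations after the words that lead the memory to state `m`. -/
def classesAt (N : MemStruct C) (W : Set (ℕ → C)) (m : N.M) : Set (Set (ℕ → C)) :=
  {q | ∃ w, N.updStar N.init w = m ∧ contAfter W w = q}

lemma contAfter_mem_classesAt (N : MemStruct C) (W : Set (ℕ → C)) (w : List C) :
    contAfter W w ∈ classesAt N W (N.updStar N.init w) := ⟨w, rfl, rfl⟩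

lemma contAfter_mem_classesAt_updStar {N : MemStruct C} {W : Set (ℕ → C)} {m : N.M}
    {q : Set (ℕ → C)} (hq : q ∈ classesAt N W m) (w : List C) :
    contAfter q w ∈ classesAt N W (N.updStar m w) := by
  obtain ⟨u, rfl, rfl⟩ := hq
  rw [← contAfter_append, ← N.updStar_append]
  exact contAfter_mem_classesAt N W _

lemma exists_least_class {N : MemStruct C} {W : Set (ℕ → C)} (hreg : FinClasses W)
    (hmono : StronglyMonotone N W) (m : N.M) (P : Set (ℕ → C) → Prop)
    (h : ∃ q ∈ classesAt N W m, P q) :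
    ∃ p ∈ classesAt N W m, P p ∧ ∀ q ∈ classesAt N W m, P q → p ⊆ q := by
  have hfin : {q | q ∈ classesAt N W m ∧ P q}.Finite :=
    Set.Finite.subset hreg (by rintro q ⟨⟨w, -, rfl⟩, -⟩; exact ⟨w, rfl⟩)
  obtain ⟨p, hp, hmin⟩ := hfin.exists_minimal h
  refine ⟨p, hp.1, hp.2, fun q hq hPq => ?_⟩
  obtain ⟨u, hu, rfl⟩ := hp.1
  obtain ⟨v, hv, rfl⟩ := hq
  exact (hmono u v (hu.trans hv.symm)).elim id
    fun h => hmin ⟨⟨v, hv, rfl⟩, hPq⟩ h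

/-- `AttrAt A α v q`: from `v`, within `α` rounds, Player 1 can force a dead end of Player 2 or a
position after which every continuation belongs to the objective `q`. -/
inductive AttrAt (A : Arena C) : Ordinal.{0} → A.V → Set (ℕ → C) → Prop
  | univ (α : Ordinal.{0}) (v : A.V) : AttrAt A α v Set.univ
  | move {α β : Ordinal.{0}} {v : A.V} {q : Set (ℕ → C)} (e : A.V × C × A.V) :
      A.P1 v → e ∈ A.E → e.1 = v → β < α →
      AttrAt A β e.2.2 (contAfter q [e.2.1]) → AttrAt A α v q
  | wait {α : Ordinal.{0}} {v : A.V} {q : Set (ℕ → C)}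
      (f : A.V × C × A.V → Ordinal.{0}) :
      ¬ A.P1 v → (∀ e ∈ A.E, e.1 = v → f e < α) →
      (∀ e ∈ A.E, e.1 = v → AttrAt A (f e) e.2.2 (contAfter q [e.2.1])) →
      AttrAt A α v q

/-- Player 1 can force a dead end of Player 2 or a position after which every continuation
belongs to the objective. -/
def Attr (A : Arena C) (v : A.V) (q : Set (ℕ → C)) : Prop := ∃ α, AttrAt A α v q

namespace Attr

variable {A : Arena C} {v : A.V} {q q' : Set (ℕ → C)}

lemma _root_.RegularMemory.AttrAt.mono {α : Ordinal} (h : AttrAt A α v q) (hq : q ⊆ q') :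
    AttrAt A α v q' := by
  induction h generalizing q' with
  | univ α v => rw [Set.univ_subset_iff.mp hq]; exact .univ α v
  | move e h1 he hv hlt _ ih => exact .move e h1 he hv hlt (ih (contAfter_mono hq _))
  | wait f h2 hlt _ ih =>
    exact .wait f h2 hlt fun e he hv => ih e he hv (contAfter_mono hq _)

lemma mono (h : Attr A v q) (hq : q ⊆ q') : Attr A v q' := h.imp fun _ h => h.mono hq

lemma of_univ : Attr A v Set.univ := ⟨0, .univ _ _⟩

lemma of_move {e : A.V × C × A.V} (h1 : A.P1 v) (he : e ∈ A.E) (hv : e.1 = v)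
    (h : Attr A e.2.2 (contAfter q [e.2.1])) : Attr A v q := by
  obtain ⟨β, hβ⟩ := h
  exact ⟨Order.succ β, .move e h1 he hv (Order.lt_succ β) hβ⟩

lemma of_wait (h2 : ¬ A.P1 v)
    (h : ∀ e ∈ A.E, e.1 = v → Attr A e.2.2 (contAfter q [e.2.1])) : Attr A v q := by
  have : ∀ e, ∃ β, e ∈ A.E → e.1 = v → AttrAt A β e.2.2 (contAfter q [e.2.1]) := fun e => by
    by_cases he : e ∈ A.E ∧ e.1 = v
    · exact (h e he.1 he.2).imp fun β hβ _ _ => hβ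
    · exact ⟨0, fun h h' => absurd ⟨h, h'⟩ he⟩
  choose f hf using this
  exact ⟨Order.succ (⨆ e, f e),
    .wait f h2 (fun e _ _ => Order.lt_succ_of_le (Ordinal.le_iSup f e)) hf⟩

lemma exists_move (h1 : A.P1 v) (hq : q ≠ Set.univ) (h : Attr A v q) :
    ∃ e ∈ A.E, e.1 = v ∧ ∀ α, AttrAt A α v q →
      ∃ β < α, AttrAt A β e.2.2 (contAfter q [e.2.1]) := by
  obtain ⟨α, hα, hmin⟩ := WellFounded.has_min
    (wellFounded_lt (α := Ordinal)) {α | AttrAt A α v q} h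
  cases hα with
  | univ => exact absurd rfl hq
  | move e _ he hv hlt hβ =>
    exact ⟨e, he, hv, fun γ hγ => ⟨_, hlt.trans_le (not_lt.mp (hmin γ hγ)), hβ⟩⟩
  | wait f h2 => exact absurd h1 h2

lemma _root_.RegularMemory.AttrAt.edge_of_wait {α : Ordinal} (h : AttrAt A α v q)
    (h2 : ¬ A.P1 v) (hq : q ≠ Set.univ) {e : A.V × C × A.V} (he : e ∈ A.E) (hv : e.1 = v) :
    ∃ β < α, AttrAt A β e.2.2 (contAfter q [e.2.1]) := by
  cases h with
  | univ => exact absurd rfl hq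
  | move _ h1 => exact absurd h1 h2
  | wait f _ hlt hf => exact ⟨f e, hlt e he hv, hf e he hv⟩

end Attr

lemma exists_initSeg_eq (e : List C → C) : ∃ x : ℕ → C, ∀ n, x n = e (initSeg x n) := by
  let h : ℕ → List C := fun n => n.rec [] fun _ l => l ++ [e l]
  have hh : ∀ n, initSeg (fun n => e (h n)) n = h n := fun n => by
    induction n with
    | zero => simp [initSeg_zero, h]
    | succ n ih => rw [initSeg_succ, ih]
  exact ⟨fun n => e (h n), fun n => by rw [hh]⟩

/-- For open objectives, Player 1 wins only from the attractor. -/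
lemma attr_of_winningFrom [Nonempty C] {A : Arena C} {v : A.V} {q : Set (ℕ → C)}
    (hq : OpenObj q) {σ : A.Strategy} (hσ : σ.WinningFrom q v) : Attr A v q := by
  by_contra hv
  have step : ∀ l, ∃ e, A.HistFrom v l →
      ¬ Attr A (A.endFrom v l) (contAfter q (l.map fun e => e.2.1)) →
      e ∈ A.E ∧ e.1 = A.endFrom v l ∧ (A.P1 (A.endFrom v l) → e = σ.next v l) ∧
        ¬ Attr A e.2.2 (contAfter q ((l.map fun e => e.2.1) ++ [e.2.1])) := by
    intro l
    by_cases hl : A.HistFrom v l ∧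
        ¬ Attr A (A.endFrom v l) (contAfter q (l.map fun e => e.2.1))
    · obtain ⟨hh, hl⟩ := hl
      by_cases h1 : A.P1 (A.endFrom v l)
      · obtain ⟨hE, hs⟩ := σ.legal v l hh h1
        refine ⟨σ.next v l, fun _ _ => ⟨hE, hs, fun _ => rfl, fun h => hl ?_⟩⟩
        rw [contAfter_append] at h
        exact .of_move h1 hE hs h
      · by_contra! hno
        refine hl (.of_wait h1 fun e he hs => ?_)
        rw [← contAfter_append]
        exact (hno e).2.2 he hs fun h => absurd h h1
    · exact ⟨(v, Classical.arbitrary C, v), fun h h' => absurd ⟨h, h'⟩ hl⟩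
  choose e he using step
  obtain ⟨π, hπ⟩ := exists_initSeg_eq e
  have inv : ∀ n, A.HistFrom v (initSeg π n) ∧ ¬ Attr A (A.endFrom v (initSeg π n))
      (contAfter q ((initSeg π n).map fun e => e.2.1)) := fun n => by
    induction n with
    | zero => simpa [initSeg_zero, HistFrom, endFrom, contAfter_nil] using hv
    | succ n ih =>
      have := he _ ih.1 ih.2
      rw [← hπ] at this
      rw [initSeg_succ, histFrom_concat, endFrom_concat, List.map_append]
      exact ⟨⟨ih.1, this.1, this.2.1⟩, this.2.2.2⟩
  have key := fun n => he _ (inv n).1 (inv n).2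
  simp only [← hπ] at key
  have hplay : A.PlayFrom v π := by
    refine ⟨?_, fun n => ⟨(key n).1, ?_⟩⟩
    · simpa [initSeg_zero, endFrom] using (key 0).2.1
    · rw [(key (n + 1)).2.1, initSeg_succ, endFrom_concat]
  obtain ⟨n, hn⟩ := hq _ (hσ π hplay fun n h1 => (key n).2.2.1 h1)
  have := (inv n).2
  rw [map_color_initSeg, hn] at this
  exact this .of_univ

open Classical in
/-- After an edge consistent with a winning strategy, Player 1 wins the residual objective. -/
lemma exists_winningFrom_contAfter {A : Arena C} {v : A.V} {q : Set (ℕ → C)}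
    {σ : A.Strategy} (hσ : σ.WinningFrom q v) {e : A.V × C × A.V} (he : e ∈ A.E)
    (hv : e.1 = v) (h1 : A.P1 v → e = σ.next v []) :
    ∃ σ' : A.Strategy, σ'.WinningFrom (contAfter q [e.2.1]) e.2.2 := by
  refine ⟨⟨fun u l => if u = e.2.2 then σ.next v (e :: l) else σ.next u l,
    fun u l hl hp => ?_⟩, fun π hπ hc => ?_⟩
  · split_ifs with hu
    · subst hu
      exact σ.legal v (e :: l) ⟨he, hv, hl⟩ hp
    · exact σ.legal u l hl hp
  · have hplay : A.PlayFrom v (fun n => n.casesOn e π) := by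
      refine ⟨hv, fun n => ?_⟩
      cases n with
      | zero => exact ⟨he, hπ.1.symm⟩
      | succ n => exact hπ.2 n
    have := hσ _ hplay fun n hn => by
      cases n with
      | zero =>
        rw [List.ofFn_zero] at hn ⊢
        exact h1 hn
      | succ n =>
        rw [List.ofFn_succ] at hn ⊢
        exact (hc n hn).trans (if_pos rfl)
    change wcat [e.2.1] (playCol π) ∈ q
    convert this using 1
    funext n
    cases n with
    | zero => rw [wcat_cons_zero]; rfl
    | succ n => rw [wcat_cons_succ, wcat_nil]; rfl

/-- It suffices to find a legal next-move function over the memory structure all of whose plays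
from a winning vertex belong to the objective. -/
lemma sufficesIn_of_nxt {N : MemStruct C} {W : Set (ℕ → C)} {P : Arena C → Prop}
    (h : ∀ A : Arena C, ∃ nxt : A.V → N.M → A.V × C × A.V,
      (∀ v m, A.P1 v → nxt v m ∈ A.E ∧ (nxt v m).1 = v) ∧
      ∀ v π, (∃ σ : A.Strategy, σ.WinningFrom W v) → A.PlayFrom v π →
        (∀ n, A.P1 (π n).1 →
          π n = nxt (π n).1 (N.updStar N.init (initSeg (playCol π) n))) →
        playCol π ∈ W) : SufficesIn N W P := by
  intro A _
  obtain ⟨nxt, hl, hwin⟩ := h A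
  exact ⟨memStrategy nxt hl, ⟨nxt, fun _ _ _ _ => rfl⟩, fun v hv π hπ hc =>
    hwin v π hv hπ (hc.eq_memStrategy hπ)⟩

lemma updStar_initSeg_succ (N : MemStruct C) (x : ℕ → C) (n : ℕ) :
    N.updStar N.init (initSeg x (n + 1)) =
      N.upd (N.updStar N.init (initSeg x n)) (x n) := by
  rw [initSeg_succ, N.updStar_append]
  rfl

/-- Strongly monotone memory suffices for regular closed objectives. -/
lemma sufficesIn_of_closedObj [Nonempty C] {N : MemStruct C} {W : Set (ℕ → C)}
    (hW : ClosedObj W) (hreg : FinClasses W) (hmono : StronglyMonotone N W)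
    {P : Arena C → Prop} : SufficesIn N W P := by
  refine sufficesIn_of_nxt fun A => ?_
  have hne : (∅ : Set (ℕ → C)) ≠ Set.univ := Set.empty_ne_univ
  have step : ∀ v m, ∃ e : A.V × C × A.V, A.P1 v → (e ∈ A.E ∧ e.1 = v) ∧
      (∀ α, AttrAt A α v ∅ → ∃ β < α, AttrAt A β e.2.2 ∅) ∧
      (¬ Attr A v ∅ → ∀ q ∈ classesAt N W m, (∃ σ : A.Strategy, σ.WinningFrom q v) →
        ∃ σ : A.Strategy, σ.WinningFrom (contAfter q [e.2.1]) e.2.2) := by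
    intro v m
    by_cases h1 : A.P1 v
    swap
    · exact ⟨(v, Classical.arbitrary C, v), fun h => absurd h h1⟩
    by_cases hD : Attr A v ∅
    · obtain ⟨e, he, hv, hd⟩ := hD.exists_move h1 hne
      exact ⟨e, fun _ => ⟨⟨he, hv⟩, hd, fun h => absurd hD h⟩⟩
    by_cases hex : ∃ q ∈ classesAt N W m, ∃ σ : A.Strategy, σ.WinningFrom q v
    · obtain ⟨p, -, ⟨σ, hσ⟩, hmin⟩ := exists_least_class hreg hmono m _ hex
      obtain ⟨hE, hs⟩ := σ.legal v [] trivial h1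
      refine ⟨σ.next v [], fun _ => ⟨⟨hE, hs⟩, fun α hα => absurd ⟨α, hα⟩ hD,
        fun _ q hq hwin => ?_⟩⟩
      exact (exists_winningFrom_contAfter hσ hE hs fun _ => rfl).imp fun σ' h π hπ hc =>
        contAfter_mono (hmin q hq hwin) _ (h π hπ hc)
    · obtain ⟨e, he, hv⟩ := A.succ v h1
      exact ⟨e, fun _ => ⟨⟨he, hv⟩, fun α hα => absurd ⟨α, hα⟩ hD,
        fun _ q hq hwin => absurd ⟨q, hq, hwin⟩ hex⟩⟩
  choose nxt hnxt using step
  refine ⟨nxt, fun v m h1 => (hnxt v m h1).1, fun v π hv hπ hc => ?_⟩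
  have hD : ∀ α n, ¬ AttrAt A α (π n).1 ∅ := by
    intro α
    induction α using WellFoundedLT.induction with
    | _ α ih =>
      intro n hα
      obtain ⟨β, hlt, hβ⟩ : ∃ β < α, AttrAt A β (π n).2.2 ∅ := by
        by_cases h1 : A.P1 (π n).1
        · rw [hc n h1]
          exact (hnxt _ _ h1).2.1 α hα
        · exact hα.edge_of_wait h1 hne (hπ.2 n).1 rfl
      exact ih β hlt (n + 1) ((hπ.2 n).2 ▸ hβ)
  have hwin : ∀ n, ∃ σ : A.Strategy,
      σ.WinningFrom (contAfter W (initSeg (playCol π) n)) (π n).1 := fun n => by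
    induction n with
    | zero => rwa [initSeg_zero, contAfter_nil, hπ.1]
    | succ n ih =>
      rw [initSeg_succ, contAfter_append, ← (hπ.2 n).2]
      by_cases h1 : A.P1 (π n).1
      · have := (hnxt _ (N.updStar N.init (initSeg (playCol π) n)) h1).2.2
          (fun ⟨α, hα⟩ => hD α n hα) _ (contAfter_mem_classesAt N W _) ih
        rwa [← hc n h1] at this
      · obtain ⟨σ, hσ⟩ := ih
        exact exists_winningFrom_contAfter hσ (hπ.2 n).1 rfl fun h => absurd h h1
  by_contra hlose
  obtain ⟨n, hn⟩ := hW _ hlose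
  obtain ⟨σ, hσ⟩ := hwin n
  rw [hn] at hσ
  obtain ⟨α, hα⟩ := attr_of_winningFrom (fun x hx => absurd hx (Set.notMem_empty x)) hσ
  exact hD α n hα

lemma exists_infinite_inter_fiber {β : Type*} {S : Set ℕ} (hS : S.Infinite) {f : ℕ → β}
    {t : Set β} (ht : t.Finite) (hf : ∀ n ∈ S, f n ∈ t) :
    ∃ y ∈ t, {n ∈ S | f n = y}.Infinite := by
  by_contra! h
  refine hS ((ht.biUnion fun y hy => h y hy).subset fun n hn => ?_)
  exact Set.mem_biUnion (hf n hn) ⟨hn, rfl⟩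

/-- The factor of `x` from position `i` (included) to position `j` (excluded). -/
def factor (x : ℕ → C) (i j : ℕ) : List C := initSeg (fun k => x (i + k)) (j - i)

lemma factor_append (x : ℕ → C) {i j k : ℕ} (hij : i ≤ j) (hjk : j ≤ k) :
    factor x i j ++ factor x j k = factor x i k := by
  simp only [factor]
  rw [show k - i = (j - i) + (k - j) by omega, initSeg_add]
  congr 2
  funext l
  congr 1
  omega

lemma factor_succ (x : ℕ → C) (i : ℕ) : factor x i (i + 1) = [x i] := by
  rw [factor, Nat.add_sub_cancel_left, initSeg_succ, initSeg_zero]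
  rfl

lemma factor_zero (x : ℕ → C) (j : ℕ) : factor x 0 j = initSeg x j := by
  simp [factor]

lemma contAfter_eq_univ_of_wpow_mem [Nonempty C] {p r : Set (ℕ → C)} (hp : OpenObj p)
    {w : List C} (hw : w ≠ []) (hpr : contAfter p w = r) (hrr : contAfter r w = r)
    (hmem : wpow w ∈ p) : r = Set.univ := by
  have hpow : ∀ k, ∃ u : List C, k ≤ u.length ∧ contAfter p u = r ∧
      wpow w = wcat u (wpow w) := fun k => by
    have hlen := List.length_pos_iff.mpr hw
    induction k with
    | zero => exact ⟨w, Nat.zero_le _, hpr, wpow_eq_wcat hw⟩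
    | succ k ih =>
      obtain ⟨u, hu, hur, hwu⟩ := ih
      refine ⟨u ++ w, by rw [List.length_append]; omega, ?_, ?_⟩
      · rw [contAfter_append, hur, hrr]
      · rw [wcat_append, ← wpow_eq_wcat hw, ← hwu]
  obtain ⟨n, hn⟩ := hp _ hmem
  obtain ⟨u, hu, hur, hwu⟩ := hpow n
  have hseg := initSeg_wcat u (wpow w) 0
  rw [← hwu, initSeg_zero, List.append_nil, Nat.add_zero] at hseg
  rw [← hur, ← hseg]
  exact contAfter_initSeg_univ_of_le hu hn

/-- If the classes tracked by the memory drop infinitely often along a word, then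
progress-consistency forces the word to be winning. -/
lemma mem_of_infinite_drops [Nonempty C] {N : MemStruct C} (hNfin : Finite N.M)
    {W : Set (ℕ → C)} (hW : OpenObj W) (hreg : FinClasses W)
    (hprog : ProgressConsistent N W) {x : ℕ → C} {p : ℕ → Set (ℕ → C)}
    (hp : ∀ n, p n ∈ classesAt N W (N.updStar N.init (initSeg x n)))
    (hpW : ∀ n, p n ⊆ contAfter W (initSeg x n))
    (hsub : ∀ n, p (n + 1) ⊆ contAfter (p n) [x n])
    (hdrop : {n | p (n + 1) ≠ contAfter (p n) [x n]}.Infinite) : x ∈ W := by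
  have hfac : ∀ i j, i ≤ j → p j ⊆ contAfter (p i) (factor x i j) := fun i j hij => by
    induction j, hij using Nat.le_induction with
    | base => simp [factor, initSeg_zero, contAfter_nil]
    | succ j hij ih =>
      rw [← factor_append x hij j.le_succ, contAfter_append, factor_succ]
      exact (hsub j).trans (contAfter_mono ih _)
  obtain ⟨⟨m, P⟩, -, hS⟩ := exists_infinite_inter_fiber hdrop
    (f := fun n => (N.updStar N.init (initSeg x (n + 1)), p (n + 1)))
    (t := Set.univ ×ˢ Set.range fun w => contAfter W w) (Set.finite_univ.prod hreg)
    (fun n _ => ⟨trivial, by obtain ⟨w, -, hw⟩ := hp (n + 1); exact ⟨w, hw⟩⟩)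
  set S := {n | n ∈ {n | p (n + 1) ≠ contAfter (p n) [x n]} ∧
    (N.updStar N.init (initSeg x (n + 1)), p (n + 1)) = (m, P)} with hSdef
  have hSm : ∀ n ∈ S, N.updStar N.init (initSeg x (n + 1)) = m := fun n hn =>
    congrArg Prod.fst hn.2
  have hSp : ∀ n ∈ S, p (n + 1) = P := fun n hn => congrArg Prod.snd hn.2
  obtain ⟨w₁, hw₁, hP⟩ : P ∈ classesAt N W m := by
    obtain ⟨n, hn⟩ := hS.nonempty
    rw [← hSp n hn, ← hSm n hn]
    exact hp _
  let g : ℕ → ℕ → Set (ℕ → C) := fun a b => contAfter P (factor x (a + 1) (b + 1))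
  have hgreg : ∀ a b, g a b ∈ Set.range fun w => contAfter W w := fun a b =>
    ⟨w₁ ++ factor x (a + 1) (b + 1), by simp only [g, contAfter_append, hP]⟩
  have hg_comp : ∀ a b c, a < b → b < c →
      contAfter (g a b) (factor x (b + 1) (c + 1)) = g a c := fun a b c hab hbc => by
    simp only [g]
    rw [← contAfter_append, factor_append x (by omega) (by omega)]
  have hPg : ∀ a ∈ S, ∀ b ∈ S, a < b → P ⊆ g a b ∧ P ≠ g a b := fun a ha b hb hab => by
    have h1 := hfac (a + 1) b hab
    have h2 : contAfter (p b) [x b] ⊆ g a b := by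
      simp only [g]
      rw [← factor_append x (Nat.succ_le_of_lt hab) b.le_succ, contAfter_append, factor_succ,
        ← hSp a ha]
      exact contAfter_mono h1 _
    have h3 := hsub b
    have h4 : p (b + 1) ≠ contAfter (p b) [x b] := hb.1
    rw [hSp b hb] at h3 h4
    exact ⟨h3.trans h2, fun h => h4 (h3.antisymm (h ▸ h2))⟩
  have hinf : ∀ a, ∀ S' ⊆ S, S'.Infinite →
      ∃ r, {b ∈ {b ∈ S' | a < b} | g a b = r}.Infinite := fun a S' _ hS' => by
    have : {b ∈ S' | a < b}.Infinite := by
      refine (hS'.sdiff (Set.finite_Iic a)).mono fun b hb => ⟨hb.1, not_le.mp hb.2⟩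
    obtain ⟨r, -, hr⟩ := exists_infinite_inter_fiber this hreg fun b _ => hgreg a b
    exact ⟨r, hr⟩
  let R : Set (Set (ℕ → C)) :=
    {r | ∃ a ∈ S, {b | b ∈ S ∧ a < b ∧ g a b = r}.Infinite}
  have hRfin : R.Finite := Set.Finite.subset hreg (by
    rintro r ⟨a, -, hr⟩
    obtain ⟨b, -, -, rfl⟩ := hr.nonempty
    exact hgreg a b)
  have hRne : R.Nonempty := by
    obtain ⟨a, ha⟩ := hS.nonempty
    obtain ⟨r, hr⟩ := hinf a S subset_rfl hS
    exact ⟨r, a, ha, hr.mono fun b hb => ⟨hb.1.1, hb.1.2, hb.2⟩⟩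
  obtain ⟨r, ⟨a, ha, hra⟩, hmin⟩ := hRfin.exists_minimal hRne
  obtain ⟨b, hbS, hab, hgab⟩ := hra.nonempty
  obtain ⟨r', hr'⟩ := hinf b _ (fun c hc => hc.1) hra
  obtain ⟨c, ⟨⟨hcS, hac, hgac⟩, hbc⟩, hgbc⟩ := hr'.nonempty
  have hr'r : r' ≤ r := by
    rw [← hgbc, ← hgac, ← hg_comp a b c hab hbc]
    exact contAfter_mono (hPg a ha b hbS hab).1 _
  have hrr' : r = r' := (hmin ⟨b, hbS, hr'.mono fun c hc =>
    ⟨hc.1.1.1, hc.1.2, hc.2⟩⟩ hr'r).antisymm hr'r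
  set w := factor x (b + 1) (c + 1) with hw
  have hPw : contAfter P w = r := hgbc.trans hrr'.symm
  have hrw : contAfter r w = r := by
    have := hg_comp a b c hab hbc
    rwa [hgab, hgac] at this
  have hlt := hPg b hbS c hcS hbc
  rw [hgbc, ← hrr'] at hlt
  have hwm : N.updStar m w = m := by
    have h1 := hSm b hbS
    have h2 := hSm c hcS
    rw [← factor_zero] at h1 h2
    rw [← factor_append x (Nat.zero_le (b + 1)) (by omega), N.updStar_append, h1] at h2
    exact h2
  have hwne : w ≠ [] := fun h => hlt.2 (by rw [← hPw, h, contAfter_nil])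
  have hpref : prefLt W w₁ (w₁ ++ w) := by
    simp only [prefLt, prefLe, contAfter_append, hP, hPw]
    exact ⟨hlt.1, fun h => hlt.2 (hlt.1.antisymm h)⟩
  have hmem : wpow w ∈ P := hP ▸ hprog m w₁ w hw₁ hwm hpref
  have huniv := contAfter_eq_univ_of_wpow_mem (hP ▸ hW.contAfter w₁) hwne hPw hrw hmem
  refine mem_of_contAfter_initSeg (n := b + 1) (Set.univ_subset_iff.mp ?_)
  rw [← huniv, ← hgab, ← factor_zero, ← factor_append x (Nat.zero_le (a + 1)) (by omega),
    contAfter_append, factor_zero]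
  exact contAfter_mono (hSp a ha ▸ hpW (a + 1)) _

/-- Strongly monotone and progress-consistent memory suffices for regular open objectives. -/
lemma sufficesIn_of_openObj [Nonempty C] {N : MemStruct C} (hNfin : Finite N.M)
    {W : Set (ℕ → C)} (hW : OpenObj W) (hreg : FinClasses W) (hmono : StronglyMonotone N W)
    (hprog : ProgressConsistent N W) {P : Arena C → Prop} : SufficesIn N W P := by
  refine sufficesIn_of_nxt fun A => ?_
  have hleast : ∀ v m, ∃ p, (∃ q ∈ classesAt N W m, Attr A v q) →
      p ∈ classesAt N W m ∧ Attr A v p ∧ ∀ q ∈ classesAt N W m, Attr A v q → p ⊆ q := by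
    intro v m
    by_cases h : ∃ q ∈ classesAt N W m, Attr A v q
    · exact (exists_least_class hreg hmono m _ h).imp fun _ h _ => h
    · exact ⟨∅, fun h' => absurd h' h⟩
  choose p hp using hleast
  have step : ∀ v m, ∃ e : A.V × C × A.V, A.P1 v → (e ∈ A.E ∧ e.1 = v) ∧
      (p v m ≠ Set.univ → ∀ α, AttrAt A α v (p v m) →
        ∃ β < α, AttrAt A β e.2.2 (contAfter (p v m) [e.2.1])) := by
    intro v m
    by_cases h1 : A.P1 v
    swap
    · exact ⟨(v, Classical.arbitrary C, v), fun h => absurd h h1⟩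
    by_cases h : p v m ≠ Set.univ ∧ Attr A v (p v m)
    · obtain ⟨e, he, hv, hd⟩ := h.2.exists_move h1 h.1
      exact ⟨e, fun _ => ⟨⟨he, hv⟩, fun _ => hd⟩⟩
    · obtain ⟨e, he, hv⟩ := A.succ v h1
      exact ⟨e, fun _ => ⟨⟨he, hv⟩, fun hne α hα => absurd ⟨hne, α, hα⟩ h⟩⟩
  choose nxt hnxt using step
  refine ⟨nxt, fun v m h1 => (hnxt v m h1).1, fun v π ⟨σ, hσ⟩ hπ hc => ?_⟩
  by_contra hlose
  let mem : ℕ → N.M := fun n => N.updStar N.init (initSeg (playCol π) n)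
  let r : ℕ → Set (ℕ → C) := fun n => p (π n).1 (mem n)
  have hmem : ∀ n, mem (n + 1) = N.updStar (mem n) [playCol π n] := fun n =>
    updStar_initSeg_succ N _ n
  have edge : ∀ n, r n ≠ Set.univ → ∀ α, AttrAt A α (π n).1 (r n) →
      ∃ β < α, AttrAt A β (π (n + 1)).1 (contAfter (r n) [playCol π n]) := by
    intro n hn α hα
    rw [← (hπ.2 n).2]
    by_cases h1 : A.P1 (π n).1
    · have := (hnxt _ (mem n) h1).2 hn α hα
      rwa [← hc n h1] at this
    · exact hα.edge_of_wait h1 hn (hπ.2 n).1 rfl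
  have hne : ∀ n, contAfter W (initSeg (playCol π) n) ≠ Set.univ := fun n h =>
    hlose (mem_of_contAfter_initSeg h)
  have inv : ∀ n, (∃ q ∈ classesAt N W (mem n), Attr A (π n).1 q) ∧
      r n ⊆ contAfter W (initSeg (playCol π) n) := fun n => by
    induction n with
    | zero =>
      have h0 : Attr A (π 0).1 (contAfter W (initSeg (playCol π) 0)) := by
        rw [initSeg_zero, contAfter_nil, hπ.1]
        exact attr_of_winningFrom hW hσ
      have hex := contAfter_mem_classesAt N W (initSeg (playCol π) 0)
      exact ⟨⟨_, hex, h0⟩, (hp _ _ ⟨_, hex, h0⟩).2.2 _ hex h0⟩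
    | succ n ih =>
      obtain ⟨hex, hsub⟩ := ih
      obtain ⟨hcl, ⟨α, hα⟩, -⟩ := hp _ _ hex
      have hrn : r n ≠ Set.univ := fun h => hne n (Set.univ_subset_iff.mp (h ▸ hsub))
      obtain ⟨β, -, hβ⟩ := edge n hrn α hα
      have hcl' := contAfter_mem_classesAt_updStar hcl [playCol π n]
      rw [← hmem] at hcl'
      refine ⟨⟨_, hcl', β, hβ⟩, ((hp _ _ ⟨_, hcl', β, hβ⟩).2.2 _ hcl' ⟨β, hβ⟩).trans ?_⟩
      rw [initSeg_succ, contAfter_append]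
      exact contAfter_mono hsub _
  have hrne : ∀ n, r n ≠ Set.univ := fun n h =>
    hne n (Set.univ_subset_iff.mp (h ▸ (inv n).2))
  have hattr : ∀ n, Attr A (π n).1 (r n) := fun n => (hp _ _ (inv n).1).2.1
  refine hlose (mem_of_infinite_drops hNfin hW hreg hprog (p := r)
    (fun n => (hp _ _ (inv n).1).1) (fun n => (inv n).2) (fun n => ?_) ?_)
  · obtain ⟨α, hα⟩ := hattr n
    obtain ⟨β, -, hβ⟩ := edge n (hrne n) α hα
    have hcl' := contAfter_mem_classesAt_updStar (hp _ _ (inv n).1).1 [playCol π n]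
    rw [← hmem] at hcl'
    exact (hp _ _ (inv (n + 1)).1).2.2 _ hcl' ⟨β, hβ⟩
  · refine Set.infinite_of_not_bddAbove fun ⟨k, hk⟩ => ?_
    have hdesc : ∀ α n, k < n → ¬ AttrAt A α (π n).1 (r n) := by
      intro α
      induction α using WellFoundedLT.induction with
      | _ α ih =>
        intro n hn hα
        obtain ⟨β, hlt, hβ⟩ := edge n (hrne n) α hα
        have heq : r (n + 1) = contAfter (r n) [playCol π n] := by
          by_contra h
          exact absurd (hk h) (not_le.mpr hn)
        exact ih β hlt (n + 1) (by omega) (heq ▸ hβ)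
    obtain ⟨α, hα⟩ := hattr (k + 1)
    exact hdesc α _ k.lt_succ_self hα

/-- finite-to-infinite, one-to-two-player lift for regular
reachability and safety objectives: a finite memory structure `N` suffices to play
optimally for `W` in all arenas iff it suffices in all finite one-player arenas of
Player 1. -/
theorem finite_to_infinite_one_to_two_player_lift {C : Type} [Nonempty C]
    (W : Set (ℕ → C))
    (hform : ∃ A : Set (List C), W = ReachObj A ∨ W = SafeObj A)
    (hreg : FinClasses W)
    (N : MemStruct C) (hNfin : Finite N.M) :
    SufficesIn N W (fun _ => True) ↔
      SufficesIn N W (fun A => A.IsFinite ∧ A.OneP1) := by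
  have hW : OpenObj W ∨ ClosedObj W := by
    obtain ⟨A, rfl | rfl⟩ := hform
    exacts [.inl (openObj_reachObj A), .inr (closedObj_safeObj A)]
  refine ⟨fun h A _ => h A trivial, fun h => ?_⟩
  have hmono := stronglyMonotone_of_sufficesIn hW hreg h
  rcases hW with hW | hW
  · exact sufficesIn_of_openObj hNfin hW hreg hmono
      (progressConsistent_of_sufficesIn (.inl hW) hreg h)
  · exact sufficesIn_of_closedObj hW hreg hmono

end RegularMemory
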